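/- arXiv:math/0605021 — 2 statements merged into one kernel-verified Lean document; each statement's English description precedes it below -/
import Mathlib

section
/- If 0 < α < 7/4, then f_α(x) = 1 - αx² has no points of (least) period 3; that is, there is no real x with f_α³(x) = x and f_α(x) ≠ x. -/
/-- f_α(x) = 1 - αx² -/
noncomputable def f (α x : ℝ) : ℝ := 1 - α * x ^ 2

/-- The elements of a real 3-cycle of `u ↦ u ^ 2 - a`, `0 < a`, sum to a root of
`s ^ 2 + s + 2 - a`. -/
theorem sum_of_three_cycle {a u v w : ℝ} (ha : 0 < a) (ha' : a < 23 / 4)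
    (huv : v = u ^ 2 - a) (hvw : w = v ^ 2 - a) (hwu : u = w ^ 2 - a) (hne : u ≠ v) :
    (u + v + w) ^ 2 + (u + v + w) + 2 - a = 0 := by
  have hprod : (u + v) * (v + w) * (w + u) = 1 := by
    apply mul_left_cancel₀ (sub_ne_zero.mpr hne)
    have h₁ : v - w = (u - v) * (u + v) := by linear_combination huv - hvw
    have h₂ : w - u = (v - w) * (v + w) := by linear_combination hvw - hwu
    have h₃ : u - v = (w - u) * (w + u) := by linear_combination hwu - huv
    linear_combination (-(v + w) * (w + u)) * h₁ - (w + u) * h₂ - h₃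
  obtain ⟨s, hs⟩ : ∃ s, s = u + v + w := ⟨_, rfl⟩
  obtain ⟨p, hp⟩ : ∃ p, p = u * v + v * w + w * u := ⟨_, rfl⟩
  obtain ⟨q, hq⟩ : ∃ q, q = u * v * w := ⟨_, rfl⟩
  have hq' : q = s * p - 1 := by
    rw [hs, hp, hq]; linear_combination -hprod
  have hsq : s ^ 2 - 2 * p = s + 3 * a := by
    rw [hs, hp]; linear_combination -huv - hvw - hwu
  have hcube : p = s ^ 3 - 3 * s * p + 3 * q - a * s := by
    rw [hs, hp, hq]; linear_combination u * huv + v * hvw + w * hwu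
  have hfactor : (2 * s - 3) * (s ^ 2 + s + 2 - a) = 0 := by
    rw [hq'] at hcube
    linear_combination -2 * hcube - hsq
  rw [← hs]
  refine (mul_eq_zero.mp hfactor).resolve_left fun h => ?_
  have hs' : s = 3 / 2 := by linarith
  have hdiff : (u * v ^ 2 + v * w ^ 2 + w * u ^ 2) - (u ^ 2 * v + v ^ 2 * w + w ^ 2 * u) =
      p - s - 3 * a := by
    rw [hs, hp]
    linear_combination (v - w + 1) * huv + (w - u + 1) * hvw + (u - v + 1) * hwu
  have hdisc : (p - s - 3 * a) ^ 2 =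
      s ^ 2 * p ^ 2 - 4 * p ^ 3 - 4 * s ^ 3 * q + 18 * s * p * q - 27 * q ^ 2 := by
    rw [← hdiff, hs, hp, hq]; ring
  have hp' : p = 3 / 8 * (1 - 4 * a) := by rw [hs'] at hsq; linarith
  rw [hq', hp', hs'] at hdisc
  have hroot : (1 + 4 * a) ^ 2 * (23 - 4 * a) = 0 := by
    linear_combination (128 / 27) * hdisc
  have : 0 < (1 + 4 * a) ^ 2 * (23 - 4 * a) := mul_pos (by positivity) (by linarith)
  exact this.ne' hroot

theorem no_period_three_below_seven_fourths (α : ℝ) (hα0 : 0 < α) (hα : α < 7 / 4) :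
    ¬ ∃ x : ℝ, f α (f α (f α x)) = x ∧ f α x ≠ x := by
  rintro ⟨x, hx, hne⟩
  obtain ⟨y, hy⟩ : ∃ y, y = f α x := ⟨_, rfl⟩
  obtain ⟨z, hz⟩ : ∃ z, z = f α y := ⟨_, rfl⟩
  rw [← hy, ← hz] at hx
  rw [← hy] at hne
  unfold f at hy hz hx
  have key := sum_of_three_cycle (u := -α * x) (v := -α * y) (w := -α * z) hα0 (by linarith)
    (by linear_combination -α * hy) (by linear_combination -α * hz)
    (by linear_combination α * hx)
    (fun h => hne (mul_left_cancel₀ (neg_ne_zero.mpr hα0.ne') h).symm)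
  nlinarith [sq_nonneg (-α * x + -α * y + -α * z + 1 / 2)]
end

section
/- Let a > √7 and T_{a,c}(x) = a - c(1+x²). Then T_{a,c} has a point of least period 3 if and only if c ∈ [a/2 - √(a²-7)/2, a/2 + √(a²-7)/2]. -/
/-- T_{a,c}(x) = a - c(1 + x²) -/
noncomputable def T (a c x : ℝ) : ℝ := a - c * (1 + x ^ 2)

/-- A real 3-cycle of `t ↦ m - t²` that is not a fixed point forces `m ≥ 7/4`: its sum `s`
satisfies `s² - s + 2 = m`. -/
theorem seven_fourths_le_of_three_cycle {m x y z : ℝ} (hy : y = m - x ^ 2) (hz : z = m - y ^ 2)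
    (hx : x = m - z ^ 2) (hne : y ≠ x) : 7 / 4 ≤ m := by
  have hyz : z - y = -(x + y) * (y - x) := by linear_combination hz - hy
  have hzx : x - z = -(y + z) * (z - y) := by linear_combination hx - hz
  have hxy : y - x = -(z + x) * (x - z) := by linear_combination hy - hx
  have hyx0 : y - x ≠ 0 := sub_ne_zero.mpr hne
  have hxz0 : x - z ≠ 0 := by
    intro h
    rw [h] at hxy
    exact hyx0 (by simpa using hxy)
  have hzy0 : z - y ≠ 0 := by
    intro h
    rw [h] at hzx
    exact hxz0 (by simpa using hzx)
  have h1 : 1 - (x + y) + (x + y) * (y + z) = 0 :=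
    mul_left_cancel₀ hyx0 (by linear_combination (y + z - 1) * hyz - hzx)
  have h2 : 1 - (y + z) + (y + z) * (z + x) = 0 :=
    mul_left_cancel₀ hzy0 (by linear_combination (z + x - 1) * hzx - hxy)
  have h3 : 1 - (z + x) + (z + x) * (x + y) = 0 :=
    mul_left_cancel₀ hxz0 (by linear_combination (x + y - 1) * hxy - hyz)
  have hs : (x + y + z) ^ 2 - (x + y + z) + 2 = m := by
    linear_combination (2 / 3) * (h1 + h2 + h3) + (1 / 3) * (hx + hy + hz)
  nlinarith [sq_nonneg (x + y + z - 1 / 2)]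

/-- For `m ≥ 7/4` the map `t ↦ m - t²` has a real point of least period 3. -/
theorem exists_three_cycle_of_seven_fourths_le {m : ℝ} (hm : 7 / 4 ≤ m) :
    ∃ x : ℝ, m - (m - (m - x ^ 2) ^ 2) ^ 2 = x ∧ m - x ^ 2 ≠ x := by
  obtain ⟨s, hs, rfl⟩ : ∃ s : ℝ, 1 / 2 ≤ s ∧ m = s ^ 2 - s + 2 := by
    have h : 0 ≤ 4 * m - 7 := by linarith
    refine ⟨(1 + √(4 * m - 7)) / 2, ?_, ?_⟩
    · linarith [Real.sqrt_nonneg (4 * m - 7)]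
    · linear_combination (-1 / 4) * Real.sq_sqrt h
  let C : ℝ → ℝ := fun t =>
    t ^ 3 - s * t ^ 2 + (-s ^ 2 + 2 * s - 3) * t + s ^ 3 - 2 * s ^ 2 + 3 * s - 1
  have hC : Continuous C := by fun_prop
  have hmem : (0 : ℝ) ∈ Set.Icc (C s) (C (2 * s + 2)) := by
    constructor
    · have : C s = -1 := by simp only [C]; ring
      linarith
    · simp only [C]
      nlinarith [mul_nonneg (sub_nonneg.mpr hs) (sub_nonneg.mpr hs),
        mul_nonneg (mul_nonneg (sub_nonneg.mpr hs) (sub_nonneg.mpr hs)) (sub_nonneg.mpr hs)]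
  obtain ⟨x, -, hx⟩ := intermediate_value_Icc (by linarith : s ≤ 2 * s + 2) hC.continuousOn hmem
  simp only [C] at hx
  set r : ℝ := 1 - s with hr
  set y : ℝ := s ^ 2 - s + 2 - x ^ 2 with hy
  set z : ℝ := s ^ 2 - s + 2 - y ^ 2 with hz
  have hΦ : 1 - (x + y) + (x + y) * (y + z) = 0 := by
    rw [hz, hy]
    linear_combination
      (x ^ 3 - r * x ^ 2 + (-r ^ 2 + 2 * r - 3) * x + r ^ 3 - 2 * r ^ 2 + 3 * r - 1) * hx
  refine ⟨x, ?_, ?_⟩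
  · linear_combination (y - x) * hΦ + (1 - y - z) * hy + (y + z) * hz
  · intro h
    have hyx : y = x := h
    have hzx : z = x := by rw [hz, hyx, h]
    rw [hzx, hyx] at hΦ
    nlinarith [sq_nonneg (4 * x - 1)]

theorem mem_Icc_iff_seven_fourths_le {a : ℝ} (ha : Real.sqrt 7 < a) (c : ℝ) :
    c ∈ Set.Icc (a / 2 - Real.sqrt (a ^ 2 - 7) / 2) (a / 2 + Real.sqrt (a ^ 2 - 7) / 2) ↔
      7 / 4 ≤ (a - c) * c := by
  have h7 : 0 ≤ a ^ 2 - 7 := sub_nonneg.mpr (Real.lt_sq_of_sqrt_lt ha).le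
  have habs : |2 * c - a| ≤ √(a ^ 2 - 7) ↔ (2 * c - a) ^ 2 ≤ a ^ 2 - 7 :=
    (Real.le_sqrt (abs_nonneg _) h7).trans (by rw [sq_abs])
  rw [Set.mem_Icc]
  constructor
  · rintro ⟨h1, h2⟩
    have := habs.mp (abs_le.mpr ⟨by linarith, by linarith⟩)
    nlinarith
  · intro h
    obtain ⟨h1, h2⟩ := abs_le.mp (habs.mpr (by nlinarith))
    constructor <;> linarith

theorem mul_T (a c x : ℝ) : c * T a c x = (a - c) * c - (c * x) ^ 2 := by
  unfold T
  ring

theorem period_three_bubble (a : ℝ) (ha : Real.sqrt 7 < a) (c : ℝ) :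
    (∃ x : ℝ, T a c (T a c (T a c x)) = x ∧ T a c x ≠ x) ↔
      c ∈ Set.Icc (a / 2 - Real.sqrt (a ^ 2 - 7) / 2) (a / 2 + Real.sqrt (a ^ 2 - 7) / 2) := by
  rw [mem_Icc_iff_seven_fourths_le ha]
  constructor
  · rintro ⟨x, h3, h1⟩
    have hc : c ≠ 0 := by
      rintro rfl
      simp only [T, zero_mul, sub_zero] at h3 h1
      exact h1 h3
    refine seven_fourths_le_of_three_cycle (mul_T a c x) (mul_T a c (T a c x)) ?_
      fun h => h1 (mul_left_cancel₀ hc h)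
    rw [← mul_T, h3]
  · intro h
    have hc : c ≠ 0 := by
      rintro rfl
      norm_num at h
    obtain ⟨x, h3, h1⟩ := exists_three_cycle_of_seven_fourths_le h
    have hx : c * (x / c) = x := mul_div_cancel₀ x hc
    refine ⟨x / c, mul_left_cancel₀ hc ?_, fun h => h1 ?_⟩
    · rw [mul_T, mul_T, mul_T, hx, h3]
    · rw [← hx, ← mul_T, h]
end
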